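/- There exists a constant C > 0 such that for all n, k ∈ ℕ with n ≥ 2 and k ≤ n^{1/4}, and all z ∈ ℤ² with 1 ≤ ‖z‖ < 5√n, the simple random walk on ℤ² started at the origin satisfies P[ R(n) ∩ Q(z,k) ≠ ∅ ] ≤ C · log( 10√n / ‖z‖ ) / log n. -/

import Mathlib

open Real

/-- A single step of the simple random walk on `ℤ^d`: the pair `(i, b)` encodes a move by
`+eᵢ` (if `b = true`) or `-eᵢ` (if `b = false`).  The uniform distribution on `Fin d × Bool`
corresponds to the uniform distribution on the `2d` unit vectors. -/
def step {d : ℕ} (a : Fin d × Bool) : Fin d → ℤ :=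
  fun j => if j = a.1 then (if a.2 then 1 else -1) else 0

/-- The position `S(k)` of the walk started at `z` after `k` steps, driven by the
sequence of i.i.d. uniform steps `ω : Fin n → Fin d × Bool` (meaningful for `k ≤ n`). -/
def walk {d n : ℕ} (z : Fin d → ℤ) (ω : Fin n → Fin d × Bool) (k : ℕ) : Fin d → ℤ :=
  z + ∑ i ∈ Finset.univ.filter (fun i : Fin n => (i : ℕ) < k), step (ω i)

/-- Probability of an event for the `n`-step simple random walk on `ℤ^d`:
the driving step sequences are uniform among the `(2d)^n` possibilities. -/
noncomputable def prW (d n : ℕ) (E : Set (Fin n → Fin d × Bool)) : ℝ :=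
  E.ncard / (2 * d) ^ n

/-- Expectation of a random variable of the `n`-step simple random walk on `ℤ^d`. -/
noncomputable def exW (d n : ℕ) (f : (Fin n → Fin d × Bool) → ℝ) : ℝ :=
  (∑ ω : Fin n → Fin d × Bool, f ω) / (2 * d) ^ n

/-- Shannon entropy (base 2) of a random variable `X` of the `n`-step walk:
`H(X) = ∑ₐ -P[X = a] · log₂ P[X = a]`. -/
noncomputable def entW {α : Type*} (d n : ℕ) (X : (Fin n → Fin d × Bool) → α) : ℝ :=
  ∑' a : α, -(prW d n {ω | X ω = a} * logb 2 (prW d n {ω | X ω = a}))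

/-- The range `R(n) = {S(0), …, S(n)}` of the `n`-step walk started at `z`. -/
def rangeW {d n : ℕ} (z : Fin d → ℤ) (ω : Fin n → Fin d × Bool) : Finset (Fin d → ℤ) :=
  (Finset.range (n + 1)).image (walk z ω)

/-- The inner boundary `∂A` of a finite set `A ⊆ ℤ^d`: the points of `A` adjacent
(at graph distance 1, i.e. reachable by a single step) to some vertex of the complement. -/
def innerBdry {d : ℕ} (A : Finset (Fin d → ℤ)) : Finset (Fin d → ℤ) :=
  A.filter fun x => ∃ a : Fin d × Bool, x + step a ∉ A

/-- The Euclidean (`L²`) norm on `ℤ^d`. -/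
noncomputable def eNorm {d : ℕ} (x : Fin d → ℤ) : ℝ :=
  Real.sqrt (∑ i, ((x i : ℝ)) ^ 2)

/-- The square `Q(z,k) = {z + (j,j′) : −k ≤ j, j′ ≤ k}` of side length `2k+1` centered at `z`. -/
def square (z : Fin 2 → ℤ) (k : ℕ) : Set (Fin 2 → ℤ) :=
  {w | ∀ i, |w i - z i| ≤ (k : ℤ)}

lemma walk_zero {d n : ℕ} (z : Fin d → ℤ) (ω : Fin n → Fin d × Bool) : walk z ω 0 = z := by
  simp [walk]

lemma walk_succ_eq_walk_tail {d n : ℕ} (z : Fin d → ℤ) (ω : Fin (n + 1) → Fin d × Bool) (k : ℕ) :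
    walk z ω (k + 1) = walk (z + step (ω 0)) (Fin.tail ω) k := by
  simp [walk, Finset.sum_filter, Fin.sum_univ_succ, Fin.tail, add_assoc]

lemma prW_le_one {d n : ℕ} [NeZero d] (E : Set (Fin n → Fin d × Bool)) : prW d n E ≤ 1 := by
  have hd : (0 : ℝ) < d := by exact_mod_cast Nat.pos_of_ne_zero (NeZero.ne d)
  have h : E.ncard ≤ (2 * d) ^ n := by
    refine (Set.ncard_le_ncard (Set.subset_univ E)).trans ?_
    simp [Set.ncard_univ, mul_comm]
  unfold prW
  rw [div_le_one (by positivity)]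
  exact_mod_cast h

/-- Conditioning on the first step: the probability of hitting `A` from `x ∉ A`
is at most the average of the hitting probabilities from the neighbours of `x`. -/
lemma prW_hit_succ_le {d n : ℕ} [NeZero d] {A : Set (Fin d → ℤ)} {x : Fin d → ℤ} (hx : x ∉ A) :
    prW d (n + 1) {ω | ∃ y ∈ rangeW x ω, y ∈ A} ≤
      (∑ a, prW d n {ω | ∃ y ∈ rangeW (x + step a) ω, y ∈ A}) / (2 * d) := by
  have hd : (0 : ℝ) < d := by exact_mod_cast Nat.pos_of_ne_zero (NeZero.ne d)
  have hsub : {ω : Fin (n + 1) → Fin d × Bool | ∃ y ∈ rangeW x ω, y ∈ A} ⊆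
      ⋃ a : Fin d × Bool, Set.image
        (fun ω => Fin.cons (α := fun _ : Fin (n + 1) => Fin d × Bool) a ω)
        {ω | ∃ y ∈ rangeW (x + step a) ω, y ∈ A} := by
    rintro ω ⟨y, hy, hyA⟩
    obtain ⟨k, hk, rfl⟩ := Finset.mem_image.1 hy
    rw [Set.mem_iUnion]
    refine ⟨ω 0, Fin.tail ω, ?_, Fin.cons_self_tail ω⟩
    cases k with
    | zero => exact absurd (walk_zero x ω ▸ hyA) hx
    | succ k =>
      rw [walk_succ_eq_walk_tail] at hyA
      exact ⟨_, Finset.mem_image_of_mem _ (by simpa using hk), hyA⟩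
  have hcard : {ω : Fin (n + 1) → Fin d × Bool | ∃ y ∈ rangeW x ω, y ∈ A}.ncard ≤
      ∑ a, {ω : Fin n → Fin d × Bool | ∃ y ∈ rangeW (x + step a) ω, y ∈ A}.ncard :=
    (Set.ncard_le_ncard hsub).trans <| (Set.ncard_iUnion_le_of_fintype _).trans <|
      Finset.sum_le_sum fun a _ => Set.ncard_image_le
  unfold prW
  rw [← Finset.sum_div, div_div, ← pow_succ]
  gcongr
  exact_mod_cast hcard

/-- Maximal inequality for space-time supersolutions: if `h s` is a nonnegative function of the
remaining time `s` and the position which is superharmonic along the walk and at least `m` on `A`,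
then the walk from `x` hits `A` within `n` steps with probability at most `h n x / m`. -/
lemma prW_hit_mul_le {d : ℕ} [NeZero d] {A : Set (Fin d → ℤ)} {m : ℝ} (hm : 0 ≤ m)
    {h : ℕ → (Fin d → ℤ) → ℝ} (hnn : ∀ s x, 0 ≤ h s x) (hA : ∀ s, ∀ x ∈ A, m ≤ h s x)
    (hsuper : ∀ s x, ∑ a, h s (x + step a) ≤ 2 * d * h (s + 1) x) (n : ℕ) (x : Fin d → ℤ) :
    prW d n {ω | ∃ y ∈ rangeW x ω, y ∈ A} * m ≤ h n x := by
  have hd : (0 : ℝ) < d := by exact_mod_cast Nat.pos_of_ne_zero (NeZero.ne d)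
  induction n generalizing x with
  | zero =>
    by_cases hx : x ∈ A
    · exact (mul_le_of_le_one_left hm (prW_le_one _)).trans (hA _ _ hx)
    · simpa [prW, rangeW, walk_zero, hx] using hnn 0 x
  | succ n ih =>
    by_cases hx : x ∈ A
    · exact (mul_le_of_le_one_left hm (prW_le_one _)).trans (hA _ _ hx)
    · calc _ ≤ (∑ a, prW d n {ω | ∃ y ∈ rangeW (x + step a) ω, y ∈ A}) / (2 * d) * m := by
            gcongr
            exact prW_hit_succ_le hx
        _ = (∑ a, prW d n {ω | ∃ y ∈ rangeW (x + step a) ω, y ∈ A} * m) / (2 * d) := by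
            rw [← Finset.sum_mul, div_mul_eq_mul_div]
        _ ≤ (∑ a, h n (x + step a)) / (2 * d) := by
            gcongr with a
            exact ih _
        _ ≤ h (n + 1) x := by
            rw [div_le_iff₀ (by positivity), mul_comm]
            exact hsuper n x

/-- Discrete supersolution property of `log ((|x|² + 1 + t) / (|x|² + 1))` on `ℤ²`, with the four
neighbours of `(p, q)` written out. -/
lemma sum_log_neighbours_le (p q t : ℝ) (ht : 0 ≤ t) :
    log (((p + 1) ^ 2 + q ^ 2 + 1 + t) / ((p + 1) ^ 2 + q ^ 2 + 1)) +
    log (((p - 1) ^ 2 + q ^ 2 + 1 + t) / ((p - 1) ^ 2 + q ^ 2 + 1)) +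
    (log ((p ^ 2 + (q + 1) ^ 2 + 1 + t) / (p ^ 2 + (q + 1) ^ 2 + 1)) +
    log ((p ^ 2 + (q - 1) ^ 2 + 1 + t) / (p ^ 2 + (q - 1) ^ 2 + 1))) ≤
      4 * log ((p ^ 2 + q ^ 2 + 1 + (t + 1)) / (p ^ 2 + q ^ 2 + 1)) := by
  rw [← log_mul (by positivity) (by positivity), ← log_mul (by positivity) (by positivity),
    ← log_mul (by positivity) (by positivity),
    show (4 : ℝ) = ((4 : ℕ) : ℝ) by norm_num, ← log_pow]
  apply log_le_log (by positivity)
  simp only [div_mul_div_comm, div_pow]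
  set r := p ^ 2 + q ^ 2 with hr
  have hr0 : 0 ≤ r := by positivity
  have hnum : ∀ v w : ℝ, (v + w) * (v - w) ≤ v ^ 2 := fun v w => by nlinarith [sq_nonneg w]
  apply div_le_div₀ (by positivity)
  · have h₁ : ((p + 1) ^ 2 + q ^ 2 + 1 + t) * ((p - 1) ^ 2 + q ^ 2 + 1 + t) ≤
        (r + 1 + (t + 1)) ^ 2 := by
      rw [hr]; convert hnum (p ^ 2 + q ^ 2 + 1 + (t + 1)) (2 * p) using 1; ring
    have h₂ : (p ^ 2 + (q + 1) ^ 2 + 1 + t) * (p ^ 2 + (q - 1) ^ 2 + 1 + t) ≤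
        (r + 1 + (t + 1)) ^ 2 := by
      rw [hr]; convert hnum (p ^ 2 + q ^ 2 + 1 + (t + 1)) (2 * q) using 1; ring
    calc _ ≤ (r + 1 + (t + 1)) ^ 2 * (r + 1 + (t + 1)) ^ 2 := by gcongr
      _ = _ := by ring
  · positivity
  · have key : ((p + 1) ^ 2 + q ^ 2 + 1) * ((p - 1) ^ 2 + q ^ 2 + 1) *
        ((p ^ 2 + (q + 1) ^ 2 + 1) * (p ^ 2 + (q - 1) ^ 2 + 1)) =
        (r + 1) ^ 4 + (2 * (r + 2) ^ 2 + 4 * (r + 2) - 1 + 16 * (p * q) ^ 2) := by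
      rw [hr]; ring
    rw [key]
    nlinarith [sq_nonneg (p * q)]

lemma sum_fin_two_prod_bool (f : Fin 2 × Bool → ℝ) :
    ∑ a, f a = f (0, true) + f (0, false) + (f (1, true) + f (1, false)) := by
  simp [Fintype.sum_prod_type]

lemma log_le_six_mul_log_one_add_sqrt_div {x : ℝ} (hx : 0 < x) :
    log x ≤ 6 * log (1 + √x / 3) := by
  have hs : 0 ≤ √x / 3 := by positivity
  have hsq : x = 9 * (√x / 3) ^ 2 := by rw [div_pow, sq_sqrt hx.le]; ring
  rw [show (6 : ℝ) = ((6 : ℕ) : ℝ) by norm_num, ← log_pow]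
  apply log_le_log hx
  set y := √x / 3
  rw [hsq]
  have : (1 + y) ^ 6 = 9 * y ^ 2 + (1 + 6 * y + 6 * y ^ 2 + 20 * y ^ 3 + 15 * y ^ 4 + 6 * y ^ 5
    + y ^ 6) := by ring
  rw [this]
  exact le_add_of_nonneg_right (by positivity)

/-- For `k ≤ n^{1/4}` and `1 ≤ ‖z‖ < 5√n`,
`P[R(n) ∩ Q(z,k) ≠ ∅] ≤ C · log(10√n/‖z‖) / log n`. -/
theorem prob_range_hits_near_square :
    ∃ C : ℝ, 0 < C ∧ ∀ n k : ℕ, 2 ≤ n → (k : ℝ) ≤ (n : ℝ) ^ ((1 : ℝ) / 4) →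
      ∀ z : Fin 2 → ℤ, 1 ≤ eNorm z → eNorm z < 5 * Real.sqrt n →
      prW 2 n {ω | ∃ x ∈ rangeW (0 : Fin 2 → ℤ) ω, x ∈ square z k} ≤
        C * Real.log (10 * Real.sqrt n / eNorm z) / Real.log n := by
  refine ⟨12, by norm_num, fun n k hn hk z hz1 hz2 => ?_⟩
  have hn2 : (2 : ℝ) ≤ n := by exact_mod_cast hn
  have hn0 : (0 : ℝ) < n := by linarith
  have hlogn : 0 < log n := log_pos (by linarith)
  have hsqrt1 : 1 ≤ √(n : ℝ) := one_le_sqrt.2 (by linarith)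
  have hsq : √(n : ℝ) ^ 2 = n := sq_sqrt hn0.le
  have hk2 : (k : ℝ) ^ 2 ≤ √n := by
    calc (k : ℝ) ^ 2 ≤ ((n : ℝ) ^ ((1 : ℝ) / 4)) ^ 2 := by gcongr
      _ = √n := by
        rw [← rpow_natCast, ← rpow_mul hn0.le, sqrt_eq_rpow]
        norm_num
  let h : ℕ → (Fin 2 → ℤ) → ℝ := fun s x =>
    log ((((x 0 : ℝ) - z 0) ^ 2 + ((x 1 : ℝ) - z 1) ^ 2 + 1 + (n + s)) /
      (((x 0 : ℝ) - z 0) ^ 2 + ((x 1 : ℝ) - z 1) ^ 2 + 1))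
  have hnn : ∀ s x, 0 ≤ h s x := fun s x => by
    apply log_nonneg
    rw [one_le_div (by positivity)]
    exact le_add_of_nonneg_right (by positivity)
  have hsuper : ∀ s x, ∑ a, h s (x + step a) ≤ 2 * (2 : ℕ) * h (s + 1) x := fun s x => by
    have := sum_log_neighbours_le ((x 0 : ℝ) - z 0) ((x 1 : ℝ) - z 1) (n + s) (by positivity)
    rw [sum_fin_two_prod_bool]
    have hp : ∀ a b : ℝ, a + 1 - b = a - b + 1 := fun a b => by ring
    have hq : ∀ a b : ℝ, a + -1 - b = a - b - 1 := fun a b => by ring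
    norm_num [h, step, hp, hq, ← add_assoc] at this ⊢
    exact this
  have htarget : ∀ s, ∀ x ∈ square z k, log n / 6 ≤ h s x := fun s x hx => by
    have hb : ∀ i, ((x i : ℝ) - z i) ^ 2 ≤ √n := fun i => by
      have h1 : |(x i : ℝ) - z i| ≤ k := by exact_mod_cast hx i
      calc ((x i : ℝ) - z i) ^ 2 = |(x i : ℝ) - z i| ^ 2 := (sq_abs _).symm
        _ ≤ (k : ℝ) ^ 2 := by gcongr
        _ ≤ √n := hk2
    have hlog := log_le_six_mul_log_one_add_sqrt_div hn0
    suffices log (1 + √n / 3) ≤ h s x by linarith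
    apply log_le_log (by positivity)
    set r := ((x 0 : ℝ) - z 0) ^ 2 + ((x 1 : ℝ) - z 1) ^ 2 + 1 with hr
    have hr0 : 0 < r := by positivity
    have hr3 : r ≤ 3 * √n := by linarith [hb 0, hb 1]
    rw [le_div_iff₀ hr0]
    have hs : (0 : ℝ) ≤ s := s.cast_nonneg
    nlinarith [mul_le_mul_of_nonneg_left hr3 (sqrt_nonneg (n : ℝ))]
  have hstart : h n 0 ≤ 2 * log (10 * √n / eNorm z) := by
    have hz0 : 0 < eNorm z := by linarith
    have hzsq : eNorm z ^ 2 = (z 0 : ℝ) ^ 2 + (z 1 : ℝ) ^ 2 := by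
      rw [eNorm, sq_sqrt (by positivity), Fin.sum_univ_two]
    have hzn : eNorm z ^ 2 ≤ 25 * n := by nlinarith
    rw [show (2 : ℝ) = ((2 : ℕ) : ℝ) by norm_num, ← log_pow]
    apply log_le_log (by positivity)
    simp only [Pi.zero_apply, Int.cast_zero, zero_sub, neg_sq, ← hzsq]
    rw [div_pow, mul_pow, hsq, div_le_div_iff₀ (by positivity) (by positivity)]
    nlinarith [sq_nonneg (eNorm z)]
  have hmain := prW_hit_mul_le (by positivity) hnn htarget hsuper n 0
  rw [le_div_iff₀ hlogn]
  linarith
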